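/- arXiv:1812.11208 — 6 statements merged into one kernel-verified Lean document; each statement's English description precedes it below -/
import Mathlib

section
/- Let T > 0 and u ∈ L^∞(0,T). Then for almost every t ∈ (0,T), the limit as x → 0⁺ of √(2/π) · x · ∫₀^t e^{−x²/(4ξ)} u(t−ξ) (2ξ)^{−3/2} dξ equals u(t). (That is, the boundary value at x = 0⁺ of the explicit solution of the boundary-controlled heat equation on the half-axis recovers the control.) -/
open MeasureTheory Set Filter
open scoped Topology


lemma aux_repr (φ ψ G : ℝ → ℝ) (M : ℝ) (hder : ∀ r ∈ Ioi (0:ℝ), HasDerivAt φ (ψ r) r)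
    (hψm : Measurable ψ)
    (hlim : Tendsto φ atTop (𝓝 0)) (hint : IntegrableOn (fun r => r * ψ r) (Ioi 0))
    (hG : Measurable G) (hM : ∀ r, |G r| ≤ M) :
    ∫ η in Ioi 0, φ η * G η = - ∫ r in Ioi 0, ψ r * ∫ η in Ioo 0 r, G η := by
  have hM0 : 0 ≤ M := (abs_nonneg _).trans (hM 0)
  have h1 : ∀ η ∈ Ioi (0:ℝ), φ η = - ∫ r in Ioi η, ψ r := by
    intro η hη
    have hη' : 0 < η := hη
    have hi : IntegrableOn ψ (Ioi η) := by
      have h2 : IntegrableOn (fun r => η⁻¹ * (r * ψ r)) (Ioi η) :=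
        (hint.mono_set (Ioi_subset_Ioi hη'.le)).const_mul _
      refine Integrable.mono h2 hψm.aestronglyMeasurable ?_
      filter_upwards [ae_restrict_mem measurableSet_Ioi] with r hr
      have hr' : η < r := hr
      have : 1 ≤ η⁻¹ * r := by
        rw [inv_mul_eq_div, le_div_iff₀ hη']; linarith
      rw [← mul_assoc, norm_mul (η⁻¹ * r), Real.norm_of_nonneg (by linarith : (0:ℝ) ≤ η⁻¹ * r)]
      nlinarith [norm_nonneg (ψ r)]
    rw [integral_Ioi_of_hasDerivAt_of_tendsto' (fun x hx => hder x (lt_of_lt_of_le hη' hx)) hi hlim]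
    ring
  let F : ℝ → ℝ → ℝ := fun η r => (Ioi η).indicator (fun r => ψ r * G η) r
  have hFm : Measurable (Function.uncurry F) := by
    have : Function.uncurry F = {p : ℝ × ℝ | p.1 < p.2}.indicator (fun p => ψ p.2 * G p.1) := by
      ext p
      simp [F, Function.uncurry, indicator]
    rw [this]
    exact Measurable.indicator (by fun_prop) (measurableSet_lt measurable_fst measurable_snd)
  have hF' : ∀ r, (fun η => F η r) = (Iio r).indicator (fun η => ψ r * G η) := by
    intro r; ext η; simp [F, indicator]
  have hFi : Integrable (Function.uncurry F)
      ((volume.restrict (Ioi (0:ℝ))).prod (volume.restrict (Ioi (0:ℝ)))) := by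
    have hsec : ∀ r, Integrable (fun η => F η r) (volume.restrict (Ioi (0:ℝ))) := by
      intro r
      rw [hF' r, integrable_indicator_iff measurableSet_Iio, IntegrableOn,
        Measure.restrict_restrict measurableSet_Iio]
      refine Integrable.const_mul ?_ _
      have hset : Iio r ∩ Ioi (0:ℝ) = Ioo 0 r := by ext; simp [and_comm]
      rw [hset]
      exact Measure.integrableOn_of_bounded (M := M) (by simp) hG.aestronglyMeasurable
        (Eventually.of_forall fun x => hM x)
    rw [integrable_prod_iff' hFm.aestronglyMeasurable]
    refine ⟨Eventually.of_forall hsec, ?_⟩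
    refine Integrable.mono (hint.const_mul M) ?_ ?_
    · exact (hFm.norm.stronglyMeasurable.integral_prod_left').aestronglyMeasurable
    · filter_upwards [ae_restrict_mem measurableSet_Ioi] with r hr
      have hr' : 0 < r := hr
      have hb : ∫ η in Ioi (0:ℝ), ‖F η r‖ ≤ ∫ η in Ioi (0:ℝ), (Iio r).indicator (fun _ => |ψ r| * M) η := by
        refine integral_mono (hsec r).norm ?_ ?_
        · rw [integrable_indicator_iff measurableSet_Iio, IntegrableOn,
            Measure.restrict_restrict measurableSet_Iio]
          refine integrableOn_const (by rw [show Iio r ∩ Ioi (0:ℝ) = Ioo 0 r by ext; simp [and_comm]]; simp)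
        · intro η
          simp only [congrFun (hF' r) η, indicator]
          split_ifs
          · rw [norm_mul]
            exact mul_le_mul_of_nonneg_left (hM η) (norm_nonneg _)
          · simp
      rw [integral_indicator measurableSet_Iio, Measure.restrict_restrict measurableSet_Iio,
        show Iio r ∩ Ioi (0:ℝ) = Ioo 0 r by ext; simp [and_comm]] at hb
      simp only [integral_const, MeasurableSet.univ, measureReal_restrict_apply, univ_inter,
        Real.volume_real_Ioo_of_le hr'.le, smul_eq_mul, sub_zero] at hb
      rw [Real.norm_of_nonneg (integral_nonneg fun _ => norm_nonneg _), norm_mul, norm_mul,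
        Real.norm_of_nonneg hM0, Real.norm_of_nonneg hr'.le, Real.norm_eq_abs]
      calc _ ≤ _ := hb
        _ = _ := by ring
  have hsw := integral_integral_swap hFi
  have hL : ∫ η in Ioi (0:ℝ), φ η * G η = - ∫ η in Ioi (0:ℝ), ∫ r in Ioi (0:ℝ), F η r := by
    rw [← integral_neg]
    refine setIntegral_congr_fun measurableSet_Ioi fun η hη => ?_
    have hη' : 0 < η := hη
    simp only [F]
    rw [integral_indicator measurableSet_Ioi, Measure.restrict_restrict measurableSet_Ioi,
      inter_eq_left.mpr (Ioi_subset_Ioi hη'.le), integral_mul_const, h1 η hη]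
    ring
  rw [hL, hsw]
  congr 1
  refine setIntegral_congr_fun measurableSet_Ioi fun r hr => ?_
  rw [hF' r, integral_indicator measurableSet_Iio, Measure.restrict_restrict measurableSet_Iio,
        show Iio r ∩ Ioi (0:ℝ) = Ioo 0 r by ext; simp [and_comm], integral_const_mul]

lemma aux_avg (v : ℝ → ℝ) (t : ℝ) 
    (hd : HasDerivAt (fun x => ∫ s in (0:ℝ)..x, v s) (v t) t)
    (hvi : ∀ a b, IntervalIntegrable v volume a b) (r : ℝ) (hr : 0 < r) :
    Tendsto (fun c : ℝ => ∫ η in Ioo 0 r, v (t - c * η)) (𝓝[>] 0) (𝓝 (r * v t)) := by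
  have h1 : HasDerivAt (fun c : ℝ => t - c * r) (-r) 0 := by
    simpa using ((hasDerivAt_id (0:ℝ)).mul_const r).const_sub t
  have h2 : HasDerivAt (fun c : ℝ => ∫ s in (0:ℝ)..(t - c * r), v s) (v t * (-r)) 0 := by
    refine HasDerivAt.comp (h₂ := fun x => ∫ s in (0:ℝ)..x, v s) (0:ℝ) ?_ h1
    simpa using hd
  have h3 := (hasDerivAt_iff_tendsto_slope.mp h2).mono_left (nhdsWithin_mono (0:ℝ) (s := Ioi 0) (fun x hx => ne_of_gt hx))
  have h4 := h3.neg
  rw [show -(v t * -r) = r * v t by ring] at h4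
  refine h4.congr' ?_
  filter_upwards [self_mem_nhdsWithin] with c hc
  have hc' : 0 < c := hc
  rw [← integral_Ioc_eq_integral_Ioo, ← intervalIntegral.integral_of_le hr.le,
    intervalIntegral.integral_comp_sub_mul (fun x => v x) hc'.ne' t]
  simp only [slope, vsub_eq_sub, sub_zero, zero_mul, smul_eq_mul, mul_zero]
  rw [intervalIntegral.integral_interval_sub_left (hvi _ _) (hvi _ _),
    intervalIntegral.integral_symm]
  ring

lemma aux_lim (φ ψ v : ℝ → ℝ) (M t : ℝ) (hder : ∀ r ∈ Ioi (0:ℝ), HasDerivAt φ (ψ r) r)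
    (hψm : Measurable ψ)
    (hlim : Tendsto φ atTop (𝓝 0)) (hint : IntegrableOn (fun r => r * ψ r) (Ioi 0))
    (hv : Measurable v) (hM : ∀ r, |v r| ≤ M)
    (hd : HasDerivAt (fun x => ∫ s in (0:ℝ)..x, v s) (v t) t)
    (hvi : ∀ a b, IntervalIntegrable v volume a b) :
    Tendsto (fun c : ℝ => ∫ η in Ioi 0, φ η * v (t - c * η)) (𝓝[>] 0)
      (𝓝 ((∫ η in Ioi 0, φ η) * v t)) := by
  have e1 : ∀ c : ℝ, ∫ η in Ioi 0, φ η * v (t - c * η)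
      = - ∫ r in Ioi 0, ψ r * ∫ η in Ioo 0 r, v (t - c * η) := fun c =>
    aux_repr φ ψ (fun η => v (t - c * η)) M hder hψm hlim hint (by fun_prop) (fun r => hM _)
  have e2 : (∫ η in Ioi 0, φ η) * v t = - ∫ r in Ioi 0, ψ r * (r * v t) := by
    rw [← integral_mul_const,
      aux_repr φ ψ (fun η => v t) M hder hψm hlim hint (by fun_prop) (fun r => hM _)]
    congr 1
    refine setIntegral_congr_fun measurableSet_Ioi fun r hr => ?_
    have hr' : (0:ℝ) < r := hr
    simp [hr'.le]
  simp only [e1]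
  rw [e2]
  refine Tendsto.neg ?_
  refine tendsto_integral_filter_of_dominated_convergence (fun r => M * ‖r * ψ r‖) ?_ ?_
    (hint.norm.const_mul M) ?_
  · refine Eventually.of_forall fun c => ?_
    refine (hψm.mul ?_).aestronglyMeasurable
    have : (fun r => ∫ η in Ioo 0 r, v (t - c * η)) =
        fun r => ∫ η, ({p : ℝ × ℝ | 0 < p.2 ∧ p.2 < p.1}.indicator (fun p => v (t - c * p.2)) (r, η)) := by
      ext r
      rw [← integral_indicator measurableSet_Ioo]
      rfl
    rw [this]
    refine (StronglyMeasurable.integral_prod_right' (Measurable.stronglyMeasurable ?_)).measurable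
    refine Measurable.indicator (by fun_prop) ?_
    exact (measurableSet_lt measurable_const measurable_snd).inter
      (measurableSet_lt measurable_snd measurable_fst)
  · refine Eventually.of_forall fun c => ?_
    filter_upwards [ae_restrict_mem measurableSet_Ioi] with r hr
    have hr' : (0:ℝ) < r := hr
    have := norm_setIntegral_le_of_norm_le_const (μ := volume) (s := Ioo 0 r) (C := M)
      (f := fun η => v (t - c * η)) (by simp) (fun η _ => hM (t - c * η))
    rw [Real.volume_real_Ioo_of_le hr'.le, sub_zero] at this
    rw [norm_mul, norm_mul, Real.norm_of_nonneg hr'.le]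
    calc _ ≤ ‖ψ r‖ * (M * r) := mul_le_mul_of_nonneg_left this (norm_nonneg _)
      _ = _ := by ring
  · filter_upwards [ae_restrict_mem measurableSet_Ioi] with r hr
    exact (aux_avg v t hd hvi r hr).const_mul _

lemma aux_int (b : ℝ) (hb : 0 < b) :
    IntegrableOn (fun r : ℝ => Real.exp (-b / r) / (2 * r) ^ ((3:ℝ)/2)) (Ioi 0) ∧
    ∫ r in Ioi (0:ℝ), Real.exp (-b / r) / (2 * r) ^ ((3:ℝ)/2)
      = 2 / 2 ^ ((3:ℝ)/2) * (√(Real.pi / b) / 2) := by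
  have key : ∀ x ∈ Ioi (0:ℝ), 2 / 2 ^ ((3:ℝ)/2) *
      ((|(-1/2:ℝ)| * x ^ ((-1/2:ℝ) - 1)) • Real.exp (-b * (x ^ (-1/2:ℝ)) ^ 2)) = Real.exp (-b / x) / (2 * x) ^ ((3:ℝ)/2) := by
    intro x hx
    have hx' : (0:ℝ) < x := hx
    have e1 : (x ^ (-1/2:ℝ)) ^ 2 = x⁻¹ := by
      rw [← Real.rpow_natCast, ← Real.rpow_mul hx'.le, ← Real.rpow_neg_one]; norm_num
    have e2 : x ^ ((-1/2:ℝ) - 1) = (x ^ ((3:ℝ)/2))⁻¹ := by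
      rw [← Real.rpow_neg hx'.le]; norm_num
    have e3 : |(-1/2:ℝ)| = 1/2 := by rw [abs_of_neg] <;> norm_num
    rw [e1, e2, e3, Real.mul_rpow (by norm_num) hx'.le, smul_eq_mul]
    rw [← div_eq_mul_inv]
    field_simp
  constructor
  · have h := ((integrableOn_Ioi_comp_rpow_iff (fun s : ℝ => Real.exp (-b * s ^ 2)) (p := -1/2) (by norm_num)).mpr
      (integrable_exp_neg_mul_sq hb).integrableOn).const_mul (2 / 2 ^ ((3:ℝ)/2))
    exact IntegrableOn.congr_fun h key measurableSet_Ioi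
  · rw [← setIntegral_congr_fun measurableSet_Ioi key, integral_const_mul,
      integral_comp_rpow_Ioi (fun s : ℝ => Real.exp (-b * s ^ 2)) (p := -1/2) (by norm_num), integral_gaussian_Ioi]

lemma aux_const : √(2 / Real.pi) * ((2:ℝ) / 2 ^ ((3:ℝ)/2) * (√(Real.pi / (1/4)) / 2)) = 1 := by
  have hp := Real.pi_pos
  have e : (2:ℝ) ^ ((3:ℝ)/2) = 2 * √2 := by
    rw [show (3:ℝ)/2 = 1 + 1/2 by norm_num, Real.rpow_add (by norm_num), Real.rpow_one, ← Real.sqrt_eq_rpow]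
  have e2 : √(Real.pi / (1/4)) = 2 * √Real.pi := by
    rw [show Real.pi / (1/4) = 2 ^ 2 * Real.pi by ring, Real.sqrt_mul (by norm_num), Real.sqrt_sq (by norm_num)]
  rw [e, e2, Real.sqrt_div (by norm_num)]
  have : √Real.pi ≠ 0 := by positivity
  field_simp

lemma aux_der (r : ℝ) (hr : 0 < r) :
    HasDerivAt (fun r : ℝ => Real.exp (-(1/4) / r) / (2 * r) ^ ((3:ℝ)/2))
      (Real.exp (-(1/4) / r) / (2 * r) ^ ((3:ℝ)/2) * (1 / (4 * r ^ 2) - 3 / (2 * r))) r := by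
  have h1 : HasDerivAt (fun r : ℝ => Real.exp (-(1/4) / r)) (Real.exp (-(1/4) / r) * (1 / (4 * r ^ 2))) r := by
    convert ((hasDerivAt_inv hr.ne').const_mul (-(1/4:ℝ))).exp using 1
    rw [div_eq_mul_inv]
    congr 1
    field_simp
  have h2 : HasDerivAt (fun r : ℝ => (2 * r) ^ ((3:ℝ)/2)) (2 * ((3:ℝ)/2) * (2 * r) ^ ((3:ℝ)/2 - 1)) r := by
    have := ((hasDerivAt_id r).const_mul 2).rpow_const (p := (3:ℝ)/2) (Or.inl (by simp [hr.ne']))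
    simpa using this
  have hp : (0:ℝ) < (2 * r) ^ ((3:ℝ)/2) := by positivity
  refine (h1.div h2 hp.ne').congr_deriv ?_
  rw [Real.rpow_sub_one (by positivity)]
  generalize (2 * r) ^ ((3:ℝ)/2) = P at *
  field_simp

lemma aux_int2 : IntegrableOn (fun r : ℝ => r * (Real.exp (-(1/4) / r) / (2 * r) ^ ((3:ℝ)/2) * (1 / (4 * r ^ 2) - 3 / (2 * r)))) (Ioi 0) := by
  have hA := ((aux_int (1/8) (by norm_num)).1.const_mul 2).add ((aux_int (1/4) (by norm_num)).1.const_mul (3/2))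
  refine Integrable.mono hA (by fun_prop) ?_
  filter_upwards [ae_restrict_mem measurableSet_Ioi] with r hr
  have hr' : (0:ℝ) < r := hr
  have hp : (0:ℝ) < (2 * r) ^ ((3:ℝ)/2) := by positivity
  have e1 : Real.exp (-(1/4) / r) = Real.exp (-(1/8) / r) * Real.exp (-(1/8) / r) := by
    rw [← Real.exp_add]; congr 1; ring
  have e2 : Real.exp (-(1/8) / r) * (1 / (4 * r)) ≤ 2 := by
    have h := Real.add_one_le_exp ((1/8) / r)
    have h' : 1 / (4 * r) ≤ 2 * Real.exp ((1/8) / r) := by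
      have : 1 / (4 * r) = 2 * ((1/8) / r) := by field_simp; norm_num
      rw [this]; linarith
    calc _ ≤ Real.exp (-(1/8) / r) * (2 * Real.exp ((1/8) / r)) := by gcongr
      _ = 2 * Real.exp (-(1/8) / r + (1/8) / r) := by rw [Real.exp_add]; ring
      _ = 2 := by rw [neg_div, neg_add_cancel]; simp
  simp only [Pi.add_apply]
  rw [Real.norm_of_nonneg (by positivity : (0:ℝ) ≤ 2 * (Real.exp (-(1/8) / r) / (2 * r) ^ ((3:ℝ)/2)) + 3/2 * (Real.exp (-(1/4) / r) / (2 * r) ^ ((3:ℝ)/2)))]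
  have e3 : r * (Real.exp (-(1/4) / r) / (2 * r) ^ ((3:ℝ)/2) * (1 / (4 * r ^ 2) - 3 / (2 * r)))
     = (Real.exp (-(1/8) / r) * (1 / (4 * r))) * (Real.exp (-(1/8) / r) / (2 * r) ^ ((3:ℝ)/2)) - 3/2 * (Real.exp (-(1/4) / r) / (2 * r) ^ ((3:ℝ)/2)) := by
    rw [e1]
    generalize (2 * r) ^ ((3:ℝ)/2) = P at *
    field_simp
  rw [e3]
  refine (norm_sub_le _ _).trans ?_
  rw [Real.norm_of_nonneg (by positivity), Real.norm_of_nonneg (by positivity)]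
  gcongr

lemma aux_tend : Tendsto (fun r : ℝ => Real.exp (-(1/4) / r) / (2 * r) ^ ((3:ℝ)/2)) atTop (𝓝 0) := by
  have h1 : Tendsto (fun r : ℝ => Real.exp (-(1/4) / r)) atTop (𝓝 (Real.exp 0)) :=
    (Real.continuous_exp.tendsto 0).comp (tendsto_const_nhds.div_atTop tendsto_id)
  exact h1.div_atTop ((tendsto_rpow_atTop (by norm_num)).comp (tendsto_id.const_mul_atTop (by norm_num)))

/-- The boundary value at `x = 0⁺` of the explicit solution of the boundary-controlled
heat equation on the half-axis recovers the control, for a.e. `t ∈ (0,T)`. -/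
theorem boundary_value_recovers_control
    (T : ℝ) (hT : 0 < T) (u : ℝ → ℝ) (hmeas : Measurable u)
    (hbdd : ∃ C : ℝ, ∀ᵐ t ∂(volume.restrict (Ioo 0 T)), |u t| ≤ C) :
    ∀ᵐ t ∂(volume.restrict (Ioo 0 T)),
      Tendsto (fun x : ℝ => Real.sqrt (2 / Real.pi) * x *
          ∫ ξ in Ioo 0 t, Real.exp (-x ^ 2 / (4 * ξ)) * u (t - ξ) / (2 * ξ) ^ ((3:ℝ)/2))
        (nhdsWithin 0 (Ioi 0)) (nhds (u t)) := by
  obtain ⟨C, hC⟩ := hbdd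
  let S : Set ℝ := Ioo 0 T ∩ {s | |u s| ≤ C}
  have hS : MeasurableSet S := measurableSet_Ioo.inter (measurableSet_le (by fun_prop) measurable_const)
  let v : ℝ → ℝ := S.indicator u
  have hv : Measurable v := hmeas.indicator hS
  have hvM : ∀ r, |v r| ≤ |C| := by
    intro r
    by_cases h : r ∈ S
    · simp only [v, indicator_of_mem h]
      exact le_trans h.2 (le_abs_self C)
    · simp [v, indicator_of_notMem h]
  have hvi : ∀ a b, IntervalIntegrable v volume a b := by
    intro a b
    rw [intervalIntegrable_iff]
    exact Measure.integrableOn_of_bounded (M := |C|) (by simp [uIoc]) hv.aestronglyMeasurable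
        (Eventually.of_forall fun x => hvM x)
  have hloc : LocallyIntegrable v volume := by
    refine (locallyIntegrable_const |C|).mono hv.aestronglyMeasurable (Eventually.of_forall fun x => ?_)
    simpa using hvM x
  have huv : ∀ᵐ s, s ∈ Ioo 0 T → v s = u s := by
    rw [ae_restrict_iff' measurableSet_Ioo] at hC
    filter_upwards [hC] with s hs hsT
    exact indicator_of_mem (show s ∈ S from ⟨hsT, hs hsT⟩) u
  rw [ae_restrict_iff' measurableSet_Ioo]
  filter_upwards [huv, LocallyIntegrable.ae_hasDerivAt_integral hloc] with t ht hd htT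
  have htv := ht htT
  have hmain := (aux_lim _ _ v |C| t aux_der (by fun_prop) aux_tend aux_int2 hv hvM (hd 0) hvi).const_mul
    (√(2 / Real.pi))
  rw [(aux_int (1/4) (by norm_num)).2, ← mul_assoc, aux_const, one_mul, htv] at hmain
  have hsq : Tendsto (fun x : ℝ => x ^ 2) (𝓝[>] 0) (𝓝[>] 0) := by
    refine tendsto_nhdsWithin_iff.mpr ⟨?_, ?_⟩
    · have : Tendsto (fun x : ℝ => x ^ 2) (𝓝 0) (𝓝 (0 ^ 2)) := (continuous_pow 2).tendsto 0
      rw [zero_pow two_ne_zero] at this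
      exact this.mono_left nhdsWithin_le_nhds
    · filter_upwards [self_mem_nhdsWithin] with x hx
      exact pow_pos (show (0:ℝ) < x from hx) 2
  refine (hmain.comp hsq).congr' ?_
  filter_upwards [self_mem_nhdsWithin] with x hx
  have hx' : (0:ℝ) < x := hx
  simp only [Function.comp_apply]
  rw [mul_assoc]
  congr 1
  -- replace u by v
  have huv' : ∀ᵐ ξ, t - ξ ∈ Ioo 0 T → v (t - ξ) = u (t - ξ) :=
    (Measure.measurePreserving_sub_left volume t).quasiMeasurePreserving.ae huv
  have s1 : ∫ ξ in Ioo 0 t, Real.exp (-x ^ 2 / (4 * ξ)) * u (t - ξ) / (2 * ξ) ^ ((3:ℝ)/2)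
      = ∫ ξ in Ioo 0 t, Real.exp (-x ^ 2 / (4 * ξ)) * v (t - ξ) / (2 * ξ) ^ ((3:ℝ)/2) := by
    refine setIntegral_congr_ae measurableSet_Ioo ?_
    filter_upwards [huv'] with ξ h1 h2
    rw [h1 ⟨by linarith [h2.2], by linarith [h2.1, htT.2]⟩]
  have s2 : ∫ ξ in Ioo 0 t, Real.exp (-x ^ 2 / (4 * ξ)) * v (t - ξ) / (2 * ξ) ^ ((3:ℝ)/2)
      = ∫ ξ in Ioi 0, Real.exp (-x ^ 2 / (4 * ξ)) * v (t - ξ) / (2 * ξ) ^ ((3:ℝ)/2) := by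
    refine (setIntegral_eq_of_subset_of_forall_sdiff_eq_zero measurableSet_Ioi Ioo_subset_Ioi_self ?_).symm
    intro ξ hξ
    have h0 : v (t - ξ) = 0 := by
      refine indicator_of_notMem (fun h => hξ.2 ⟨hξ.1, ?_⟩) u
      linarith [h.1.1]
    simp [h0]
  have s3 := integral_comp_mul_left_Ioi
    (fun ξ => Real.exp (-x ^ 2 / (4 * ξ)) * v (t - ξ) / (2 * ξ) ^ ((3:ℝ)/2)) 0 (pow_pos hx' 2)
  rw [mul_zero, smul_eq_mul] at s3
  have s4 : ∫ η in Ioi (0:ℝ), Real.exp (-x ^ 2 / (4 * (x ^ 2 * η))) * v (t - x ^ 2 * η) / (2 * (x ^ 2 * η)) ^ ((3:ℝ)/2)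
      = (x ^ 3)⁻¹ * ∫ η in Ioi (0:ℝ), Real.exp (-(1/4) / η) / (2 * η) ^ ((3:ℝ)/2) * v (t - x ^ 2 * η) := by
    rw [← integral_const_mul]
    refine setIntegral_congr_fun measurableSet_Ioi fun η hη => ?_
    have hη' : (0:ℝ) < η := hη
    have e1 : (2 * (x ^ 2 * η)) ^ ((3:ℝ)/2) = x ^ 3 * (2 * η) ^ ((3:ℝ)/2) := by
      rw [show 2 * (x ^ 2 * η) = x ^ 2 * (2 * η) by ring, Real.mul_rpow (by positivity) (by positivity)]
      congr 1
      rw [← Real.rpow_natCast, ← Real.rpow_mul hx'.le, ← Real.rpow_natCast]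
      norm_num
    have e2 : -x ^ 2 / (4 * (x ^ 2 * η)) = -(1/4) / η := by field_simp
    rw [e1, e2]
    have hp : (0:ℝ) < (2 * η) ^ ((3:ℝ)/2) := by positivity
    field_simp
  rw [s1, s2]
  rw [s4] at s3
  generalize (∫ ξ in Ioi 0, Real.exp (-x ^ 2 / (4 * ξ)) * v (t - ξ) / (2 * ξ) ^ ((3:ℝ)/2)) = I at *
  have : I = x ^ 2 * ((x ^ 2)⁻¹ * I) := by field_simp
  rw [this, ← s3]
  generalize (∫ η in Ioi (0:ℝ), Real.exp (-(1/4) / η) / (2 * η) ^ ((3:ℝ)/2) * v (t - x ^ 2 * η)) = J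
  field_simp
end

section
/- Let T > 0 and g ∈ L^∞(0,T). Then ( ∫_ℝ (2/π) · σ² · | ∫₀^T e^{−σ²(T−ξ)} g(ξ) dξ |² dσ )^{1/2} ≤ ‖g‖_{L^∞(0,T)} · (2⁵ T/π)^{1/4}. (This is the L²-norm bound for the Fourier image of the input-to-state map Φ_T of the controlled heat equation.) -/
open MeasureTheory Set Filter
open scoped Topology

lemma aux_exp (x : ℝ) (hx : 0 ≤ x) : (1 - Real.exp (-x)) ^ 2 * (1 + x) ≤ 1.55 * x := by
  have h1 : 0 ≤ 1 - Real.exp (-x) := by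
    have : Real.exp (-x) ≤ 1 := Real.exp_le_one_iff.2 (by linarith)
    linarith
  have h2 : 1 - Real.exp (-x) ≤ 1 := by linarith [Real.exp_pos (-x)]
  by_cases h : 2 ≤ x
  · have : (1 - Real.exp (-x)) ^ 2 ≤ 1 := pow_le_one₀ h1 h2
    nlinarith
  · push Not at h
    have h3 : 1 - x / 2 ≤ Real.exp (-x / 2) := by
      have := Real.add_one_le_exp (-x / 2)
      linarith
    have h4 : Real.exp (-x) = Real.exp (-x / 2) ^ 2 := by
      rw [← Real.exp_nat_mul]; congr 1; push_cast; ring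
    have h5 : (1 - x / 2) ^ 2 ≤ Real.exp (-x / 2) ^ 2 :=
      pow_le_pow_left₀ (by linarith) h3 2
    have h6 : 1 - Real.exp (-x) ≤ x * (1 - x / 4) := by rw [h4]; nlinarith
    have h7 : (1 - Real.exp (-x)) ^ 2 ≤ (x * (1 - x / 4)) ^ 2 := pow_le_pow_left₀ h1 h6 2
    have h8 : x * (1 - x / 4) ^ 2 * (1 + x) ≤ 1.55 := by
      nlinarith [sq_nonneg (x * (x - 1.75)), sq_nonneg (x - 1.75), mul_nonneg hx (sq_nonneg (x - 1.75)),
        mul_nonneg (mul_nonneg hx (by linarith : 0 ≤ 2 - x)) (sq_nonneg (x - 1.75)),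
        mul_nonneg (by linarith : 0 ≤ 2 - x) (sq_nonneg (x - 1.75)), sq_nonneg (x^2 - 3.5 * x + 3)]
    calc _ ≤ (x * (1 - x / 4)) ^ 2 * (1 + x) := by gcongr
      _ = x * (x * (1 - x / 4) ^ 2 * (1 + x)) := by ring
      _ ≤ x * 1.55 := by gcongr
      _ = _ := by ring

lemma aux_inner (T M : ℝ) (hT : 0 < T) (g : ℝ → ℝ)
    (hbd : ∀ᵐ ξ ∂(volume.restrict (Ioo 0 T)), |g ξ| ≤ M) (σ : ℝ) (hσ : σ ≠ 0) :
    |∫ ξ in Ioo 0 T, Real.exp (-σ ^ 2 * (T - ξ)) * g ξ|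
      ≤ M * ((1 - Real.exp (-(T * σ ^ 2))) / σ ^ 2) := by
  have hc : Continuous fun ξ : ℝ => Real.exp (-σ ^ 2 * (T - ξ)) * M := by fun_prop
  have hi : IntegrableOn (fun ξ : ℝ => Real.exp (-σ ^ 2 * (T - ξ)) * M) (Ioo 0 T) :=
    (hc.integrableOn_Icc (a := 0) (b := T)).mono_set Ioo_subset_Icc_self
  have hle := norm_integral_le_of_norm_le (f := fun ξ => Real.exp (-σ ^ 2 * (T - ξ)) * g ξ) hi (by
    filter_upwards [hbd] with ξ h
    rw [norm_mul, Real.norm_eq_abs, Real.norm_eq_abs, Real.abs_exp]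
    gcongr)
  rw [Real.norm_eq_abs] at hle
  refine hle.trans (le_of_eq ?_)
  rw [← integral_Ioc_eq_integral_Ioo, ← intervalIntegral.integral_of_le hT.le]
  have hσ2 : σ ^ 2 ≠ 0 := pow_ne_zero 2 hσ
  rw [intervalIntegral.integral_eq_sub_of_hasDerivAt
    (f := fun ξ => M * (Real.exp (-σ ^ 2 * (T - ξ)) / σ ^ 2))]
  · simp only [sub_self, mul_zero, Real.exp_zero, sub_zero]
    rw [show -σ ^ 2 * T = -(T * σ ^ 2) by ring]
    ring
  · intro x _
    have h1 : HasDerivAt (fun ξ : ℝ => -σ ^ 2 * (T - ξ)) (-σ ^ 2 * (-1)) x :=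
      ((hasDerivAt_id x).const_sub T).const_mul _
    have h2 := (h1.exp.div_const (σ ^ 2)).const_mul M
    have h3 : M * (Real.exp (-σ ^ 2 * (T - x)) * (-σ ^ 2 * (-1)) / σ ^ 2)
        = Real.exp (-σ ^ 2 * (T - x)) * M := by
      field_simp
    rw [h3] at h2
    exact h2
  · exact hc.intervalIntegrable _ _

/-- `L²` bound for the Fourier image of the input-to-state map `Φ_T` of the controlled
heat equation: `‖F Φ_T g‖_{L²} ≤ ‖g‖_{L^∞(0,T)} (2⁵ T/π)^{1/4}`. -/
theorem fourier_input_to_state_bound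
    (T M : ℝ) (hT : 0 < T) (hM : 0 ≤ M) (g : ℝ → ℝ) (hg : Measurable g)
    (hbd : ∀ᵐ ξ ∂(volume.restrict (Ioo 0 T)), |g ξ| ≤ M) :
    Real.sqrt (∫ σ : ℝ, (2 / Real.pi) * σ ^ 2 *
        (∫ ξ in Ioo 0 T, Real.exp (-σ ^ 2 * (T - ξ)) * g ξ) ^ 2)
      ≤ M * (2 ^ 5 * T / Real.pi) ^ ((1:ℝ)/4) := by
  have hpi := Real.pi_pos
  have hs : 0 < Real.sqrt T := Real.sqrt_pos.2 hT
  have hint : Integrable (fun σ : ℝ =>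
      (2 / Real.pi * M ^ 2 * 1.55 * T) * (1 + (Real.sqrt T * σ) ^ 2)⁻¹) :=
    (integrable_inv_one_add_sq.comp_mul_left' hs.ne').const_mul _
  have key : (∫ σ : ℝ, (2 / Real.pi) * σ ^ 2 *
        (∫ ξ in Ioo 0 T, Real.exp (-σ ^ 2 * (T - ξ)) * g ξ) ^ 2) ≤ 3.1 * Real.sqrt T * M ^ 2 := by
    have h := integral_mono_of_nonneg (μ := volume) (f := fun σ : ℝ => (2 / Real.pi) * σ ^ 2 *
        (∫ ξ in Ioo 0 T, Real.exp (-σ ^ 2 * (T - ξ)) * g ξ) ^ 2)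
        (Eventually.of_forall fun σ => by positivity) hint (Eventually.of_forall fun σ => by
          dsimp only
          rw [mul_pow, Real.sq_sqrt hT.le]
          by_cases hσ : σ = 0
          · subst hσ
            simp only [ne_eq, OfNat.ofNat_ne_zero, not_false_eq_true, zero_pow, mul_zero, zero_mul]
            positivity
          have h1 := aux_inner T M hT g hbd σ hσ
          have h2 := aux_exp (T * σ ^ 2) (by positivity)
          have hσ2 : 0 < σ ^ 2 := by positivity
          have h3 := pow_le_pow_left₀ (abs_nonneg _) h1 2
          rw [sq_abs] at h3
          calc _ ≤ (2 / Real.pi) * σ ^ 2 *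
                (M * ((1 - Real.exp (-(T * σ ^ 2))) / σ ^ 2)) ^ 2 := by gcongr
            _ = (2 / Real.pi) * M ^ 2 * ((1 - Real.exp (-(T * σ ^ 2))) ^ 2 / σ ^ 2) := by
                field_simp
            _ ≤ (2 / Real.pi) * M ^ 2 * (1.55 * T * (1 + T * σ ^ 2)⁻¹) := by
                gcongr
                rw [← div_eq_mul_inv, div_le_div_iff₀ hσ2 (by positivity)]
                linarith
            _ = _ := by ring)
    refine h.trans (le_of_eq ?_)
    rw [integral_const_mul, Measure.integral_comp_mul_left (fun x : ℝ => (1 + x ^ 2)⁻¹),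
      integral_univ_inv_one_add_sq, abs_of_pos (inv_pos.2 hs), smul_eq_mul]
    nth_rewrite 1 [← Real.sq_sqrt hT.le]
    field_simp
    ring
  have hA : 0 ≤ 2 ^ 5 * T / Real.pi := by positivity
  apply Real.sqrt_le_iff.2 ⟨by positivity, key.trans ?_⟩
  rw [mul_pow, ← Real.rpow_natCast (_ ^ ((1:ℝ)/4)) 2, ← Real.rpow_mul hA,
    show (1:ℝ) / 4 * (2 : ℕ) = 1 / 2 by norm_num, ← Real.sqrt_eq_rpow, mul_comm]
  gcongr
  apply Real.le_sqrt_of_sq_le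
  rw [mul_pow, Real.sq_sqrt hT.le, le_div_iff₀ hpi]
  nlinarith [Real.pi_lt_d2]
end

section
/- Let T > 0, let n ≥ 0 and l ≥ 1 be integers with (n+1)/l ≤ T, and define u_l^n on (0,T) by u_l^n(ξ) = (−1)^{n−j} · C(n,j) · l^{n+1} for ξ ∈ (j/l, (j+1)/l), j = 0,…,n, and u_l^n(ξ) = 0 for ξ ∈ ((n+1)/l, T), where C(n,j) is the binomial coefficient. Then for every σ ≠ 0, ∫₀^T e^{ξσ²} u_l^n(ξ) dξ = l^{n+1} (e^{σ²/l} − 1)^{n+1} / σ². -/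
open MeasureTheory Set Filter
open scoped Topology

/-- The explicit step control `u_l^n`: equal to `(-1)^(n-j) C(n,j) l^(n+1)` on
`(j/l, (j+1)/l)` for `j = 0,…,n`, and `0` elsewhere. -/
noncomputable def stepControl (n l : ℕ) (ξ : ℝ) : ℝ :=
  ∑ j ∈ Finset.range (n + 1),
    if (j : ℝ) / l < ξ ∧ ξ < ((j : ℝ) + 1) / l
      then (-1) ^ (n - j) * (n.choose j : ℝ) * (l : ℝ) ^ (n + 1) else 0

/-- Exponential moments of the step controls `u_l^n`:
`∫₀^T e^{ξσ²} u_l^n(ξ) dξ = l^{n+1}(e^{σ²/l} − 1)^{n+1}/σ²`. -/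
theorem step_control_exponential_moment
    (T : ℝ) (hT : 0 < T) (n l : ℕ) (hl : 1 ≤ l)
    (hnl : ((n : ℝ) + 1) / l ≤ T) (σ : ℝ) (hσ : σ ≠ 0) :
    ∫ ξ in Ioo 0 T, Real.exp (ξ * σ ^ 2) * stepControl n l ξ
      = (l : ℝ) ^ (n + 1) * (Real.exp (σ ^ 2 / l) - 1) ^ (n + 1) / σ ^ 2 := by
  have hl0 : (0 : ℝ) < l := by exact_mod_cast hl
  have hs : σ ^ 2 ≠ 0 := pow_ne_zero 2 hσ
  -- the integral of the exponential over one step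
  have key : ∀ a b : ℝ, a ≤ b →
      ∫ ξ in Ioo a b, Real.exp (ξ * σ ^ 2)
        = (Real.exp (b * σ ^ 2) - Real.exp (a * σ ^ 2)) / σ ^ 2 := by
    intro a b hab
    rw [← integral_Ioc_eq_integral_Ioo, ← intervalIntegral.integral_of_le hab]
    have h := intervalIntegral.integral_eq_sub_of_hasDerivAt
      (f := fun x : ℝ => Real.exp (x * σ ^ 2) / σ ^ 2)
      (f' := fun x : ℝ => Real.exp (x * σ ^ 2)) (a := a) (b := b)
      (fun x _ => by
        have h1 := (((hasDerivAt_id x).mul_const (σ ^ 2)).exp).div_const (σ ^ 2)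
        refine HasDerivAt.congr_deriv h1 ?_
        simp only [id]
        rw [one_mul, mul_div_assoc, div_self hs, mul_one])
      (by apply Continuous.intervalIntegrable; fun_prop)
    rw [h]
    ring
  have hfun : ∀ ξ : ℝ, Real.exp (ξ * σ ^ 2) * stepControl n l ξ
      = ∑ j ∈ Finset.range (n + 1),
        (Ioo ((j : ℝ) / l) (((j : ℝ) + 1) / l)).indicator
          (fun x => ((-1) ^ (n - j) * (n.choose j : ℝ) * (l : ℝ) ^ (n + 1))
            * Real.exp (x * σ ^ 2)) ξ := by
    intro ξ
    unfold stepControl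
    rw [Finset.mul_sum]
    refine Finset.sum_congr rfl fun j _ => ?_
    simp only [indicator_apply, mem_Ioo]
    split_ifs <;> ring
  simp_rw [hfun]
  have hcont : ∀ c : ℝ, IntegrableOn (fun x : ℝ => c * Real.exp (x * σ ^ 2)) (Ioo 0 T) := by
    intro c
    have : Continuous (fun x : ℝ => c * Real.exp (x * σ ^ 2)) := by fun_prop
    exact (this.integrableOn_Icc (a := 0) (b := T)).mono_set Ioo_subset_Icc_self
  rw [integral_finsetSum _ (fun j _ => (hcont _).indicator measurableSet_Ioo)]
  set q := Real.exp (σ ^ 2 / l) with hq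
  have hterm : ∀ j ∈ Finset.range (n + 1),
      ∫ ξ in Ioo 0 T, (Ioo ((j : ℝ) / l) (((j : ℝ) + 1) / l)).indicator
          (fun x => ((-1) ^ (n - j) * (n.choose j : ℝ) * (l : ℝ) ^ (n + 1))
            * Real.exp (x * σ ^ 2)) ξ
        = (q ^ j * (-1) ^ (n - j) * (n.choose j : ℝ))
            * ((l : ℝ) ^ (n + 1) * (q - 1) / σ ^ 2) := by
    intro j hj
    have hjn : (j : ℝ) ≤ n := by
      exact_mod_cast Nat.lt_succ_iff.mp (Finset.mem_range.mp hj)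
    rw [setIntegral_indicator measurableSet_Ioo, inter_eq_self_of_subset_right,
      integral_const_mul, key]
    · have e1 : Real.exp ((j : ℝ) / l * σ ^ 2) = q ^ j := by
        rw [hq, ← Real.exp_nat_mul]; congr 1; ring
      have e2 : Real.exp (((j : ℝ) + 1) / l * σ ^ 2) = q ^ (j + 1) := by
        rw [hq, ← Real.exp_nat_mul]; congr 1; push_cast; ring
      rw [e1, e2]
      ring
    · gcongr; linarith
    · apply Ioo_subset_Ioo
      · positivity
      · refine le_trans ?_ hnl
        gcongr
  rw [Finset.sum_congr rfl hterm, ← Finset.sum_mul, ← add_pow, ← sub_eq_add_neg]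
  ring
end

section
/- Let T > 0 and let n ≥ 0 be an integer. Define φ_n(σ) = σ^{2n+1} e^{−Tσ²} and, for an integer l ≥ 1, φ_n^l(σ) = σ^{2n+1} e^{−Tσ²} ( (e^{σ²/l} − 1)/(σ²/l) )^{n+1} for σ ∈ ℝ (with the convention that the last factor equals 1 at σ = 0). Then ‖φ_n − φ_n^l‖_{L²(ℝ)} → 0 as l → ∞. -/
open MeasureTheory Set Filter
open scoped Topology

/-- `φ_n(σ) = σ^{2n+1} e^{−Tσ²}`. -/
noncomputable def phiFun (T : ℝ) (n : ℕ) (σ : ℝ) : ℝ :=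
  σ ^ (2 * n + 1) * Real.exp (-T * σ ^ 2)

/-- `φ_n^l(σ) = σ^{2n+1} e^{−Tσ²} ((e^{σ²/l} − 1)/(σ²/l))^{n+1}`, with the convention
that the last factor equals `1` at `σ = 0`. -/
noncomputable def phiFunApprox (T : ℝ) (n l : ℕ) (σ : ℝ) : ℝ :=
  σ ^ (2 * n + 1) * Real.exp (-T * σ ^ 2) *
    (if σ = 0 then 1 else ((Real.exp (σ ^ 2 / l) - 1) / (σ ^ 2 / l)) ^ (n + 1))

/-- The factor lies between `1` and `exp x`. -/
theorem factor_bounds (x : ℝ) (hx : 0 < x) :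
    1 ≤ (Real.exp x - 1) / x ∧ (Real.exp x - 1) / x ≤ Real.exp x := by
  constructor
  · rw [le_div_iff₀ hx]
    linarith [Real.add_one_le_exp x]
  · rw [div_le_iff₀ hx]
    have h1 := Real.add_one_le_exp (-x)
    have h2 : Real.exp x * Real.exp (-x) = 1 := by
      rw [← Real.exp_add]; simp
    nlinarith [mul_le_mul_of_nonneg_left h1 (Real.exp_pos x).le]

/-- The factor tends to `1` at `0`. -/
theorem factor_tendsto (s : ℝ) (hs : 0 < s) :
    Tendsto (fun l : ℕ => (Real.exp (s / l) - 1) / (s / l)) atTop (𝓝 1) := by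
  have h0 : Tendsto (fun l : ℕ => s / (l : ℝ)) atTop (𝓝 0) :=
    tendsto_const_div_atTop_nhds_zero_nat s
  have h1 : Tendsto (fun l : ℕ => Real.exp (s / (l : ℝ))) atTop (𝓝 1) := by
    have := (Real.continuous_exp.tendsto 0).comp h0
    simpa [Function.comp_def] using this
  refine tendsto_of_tendsto_of_tendsto_of_le_of_le' tendsto_const_nhds h1 ?_ ?_
  · filter_upwards [eventually_gt_atTop 0] with l hl
    exact (factor_bounds _ (div_pos hs (by exact_mod_cast hl))).1
  · filter_upwards [eventually_gt_atTop 0] with l hl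
    exact (factor_bounds _ (div_pos hs (by exact_mod_cast hl))).2

theorem diff_bound (T : ℝ) (n l : ℕ) (hl : 0 < l) (hlT : 2 * ((n : ℝ) + 1) / T ≤ l)
    (hT : 0 < T) (σ : ℝ) :
    (phiFun T n σ - phiFunApprox T n l σ) ^ 2 ≤ σ ^ (4 * n + 2) * Real.exp (-T * σ ^ 2) := by
  by_cases hσ : σ = 0
  · simp [phiFun, phiFunApprox, hσ]
  have hl' : (0 : ℝ) < l := by exact_mod_cast hl
  have hs : 0 < σ ^ 2 := by positivity
  obtain ⟨h1, h2⟩ := factor_bounds (σ ^ 2 / l) (div_pos hs hl')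
  simp only [phiFun, phiFunApprox, hσ, if_false]
  set g := (Real.exp (σ ^ 2 / l) - 1) / (σ ^ 2 / l)
  have h3 : 1 ≤ g ^ (n + 1) := one_le_pow₀ h1
  have h4 : g ^ (n + 1) ≤ Real.exp (T / 2 * σ ^ 2) := by
    calc g ^ (n + 1) ≤ Real.exp (σ ^ 2 / l) ^ (n + 1) :=
          pow_le_pow_left₀ (by linarith) h2 _
      _ = Real.exp (((n + 1 : ℕ) : ℝ) * (σ ^ 2 / l)) := (Real.exp_nat_mul _ _).symm
      _ ≤ _ := by
        apply Real.exp_le_exp.mpr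
        rw [div_le_iff₀ hT] at hlT
        push_cast
        rw [mul_div_assoc', div_le_iff₀ hl']
        nlinarith
  have h5 : (1 - g ^ (n + 1)) ^ 2 ≤ Real.exp (T / 2 * σ ^ 2) ^ 2 := by
    apply sq_le_sq'
    · linarith
    · linarith [Real.exp_pos (T / 2 * σ ^ 2)]
  have h6 : Real.exp (-T * σ ^ 2) ^ 2 * Real.exp (T / 2 * σ ^ 2) ^ 2
      = Real.exp (-T * σ ^ 2) := by
    rw [← Real.exp_nat_mul, ← Real.exp_nat_mul, ← Real.exp_add]
    congr 1
    push_cast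
    ring
  calc _ = σ ^ (4 * n + 2) * (Real.exp (-T * σ ^ 2) ^ 2 * (1 - g ^ (n + 1)) ^ 2) := by ring
    _ ≤ σ ^ (4 * n + 2) * (Real.exp (-T * σ ^ 2) ^ 2 * Real.exp (T / 2 * σ ^ 2) ^ 2) := by
        have : 0 ≤ σ ^ (4 * n + 2) := Even.pow_nonneg ⟨2 * n + 1, by ring⟩ σ
        gcongr
    _ = _ := by rw [h6]

/-- `‖φ_n − φ_n^l‖_{L²(ℝ)} → 0` as `l → ∞`. -/
theorem phiFunApprox_tendsto (T : ℝ) (hT : 0 < T) (n : ℕ) :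
    Tendsto (fun l : ℕ => Real.sqrt (∫ σ : ℝ, (phiFun T n σ - phiFunApprox T n l σ) ^ 2))
      atTop (nhds 0) := by
  have key : Tendsto (fun l : ℕ => ∫ σ : ℝ, (phiFun T n σ - phiFunApprox T n l σ) ^ 2)
      atTop (𝓝 (∫ _ : ℝ, (0 : ℝ))) := by
    refine tendsto_integral_filter_of_dominated_convergence
      (fun σ => σ ^ (4 * n + 2) * Real.exp (-T * σ ^ 2)) ?_ ?_ ?_ ?_
    · refine Eventually.of_forall fun l => Measurable.aestronglyMeasurable ?_
      unfold phiFun phiFunApprox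
      have : Measurable fun σ : ℝ => if σ = 0 then (1 : ℝ) else
          ((Real.exp (σ ^ 2 / l) - 1) / (σ ^ 2 / l)) ^ (n + 1) :=
        Measurable.ite (measurableSet_singleton 0) measurable_const (by fun_prop)
      fun_prop
    · obtain ⟨L, hL⟩ := exists_nat_ge (2 * ((n : ℝ) + 1) / T)
      filter_upwards [eventually_gt_atTop 0, eventually_ge_atTop L] with l hl hlL
      refine Eventually.of_forall fun σ => ?_
      rw [Real.norm_of_nonneg (sq_nonneg _)]
      exact diff_bound T n l hl (hL.trans (by exact_mod_cast hlL)) hT σ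
    · have := integrable_rpow_mul_exp_neg_mul_sq hT (s := ((4 * n + 2 : ℕ) : ℝ))
        (lt_of_lt_of_le (by norm_num) (Nat.cast_nonneg _))
      simpa only [Real.rpow_natCast] using this
    · refine Eventually.of_forall fun σ => ?_
      by_cases hσ : σ = 0
      · simp [phiFun, phiFunApprox, hσ]
      · have hg := (factor_tendsto (σ ^ 2) (by positivity)).pow (n + 1)
        have h := ((hg.const_mul (σ ^ (2 * n + 1) * Real.exp (-T * σ ^ 2))).const_sub
          (σ ^ (2 * n + 1) * Real.exp (-T * σ ^ 2))).pow 2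
        simpa [phiFun, phiFunApprox, hσ] using h
  have := (Real.continuous_sqrt.tendsto _).comp key
  simpa [Function.comp_def] using this
end

section
/- For all integers n ≥ p ≥ 0, (2n+1)! / ( 2^{2n+1} ((n−p)!)² ) ≤ (e/(√2 · π)) · (n+1)^{2p + 1/2}. -/
theorem central_ratio_sq (n : ℕ) :
    (((2 * n + 1).factorial : ℝ) / (2 ^ (2 * n + 1) * (n.factorial : ℝ) ^ 2)) ^ 2
      ≤ ((n : ℝ) + 1) / Real.pi := by
  have h := Real.Wallis.le_W n
  rw [Real.Wallis.W_eq_factorial_ratio] at h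
  have hpi := Real.pi_pos
  have hF : (0 : ℝ) < (n.factorial : ℝ) := by exact_mod_cast n.factorial_pos
  have hG : (0 : ℝ) < ((2 * n).factorial : ℝ) := by exact_mod_cast (2 * n).factorial_pos
  have h2 : (2 : ℝ) ^ (4 * n) = ((2 : ℝ) ^ (2 * n)) ^ 2 := by rw [← pow_mul]; ring_nf
  rw [h2] at h
  rw [Nat.factorial_succ, pow_succ (2 : ℝ) (2 * n)]
  push_cast
  have hT : (0 : ℝ) < 2 ^ (2 * n) := by positivity
  generalize (2 : ℝ) ^ (2 * n) = T at *
  generalize ((2 * n).factorial : ℝ) = G at *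
  generalize (n.factorial : ℝ) = F at *
  have hn : (0 : ℝ) ≤ n := Nat.cast_nonneg n
  generalize (n : ℝ) = x at *
  rw [div_mul_div_comm, div_le_div_iff₀ (by positivity) (by positivity)] at h
  rw [div_pow, div_le_div_iff₀ (by positivity) (by positivity)]
  have e1 : (2 * x + 1) * Real.pi * (G ^ 2 * (2 * x + 1)) = ((2 * x + 1) * G) ^ 2 * Real.pi := by
    ring
  rw [e1] at h
  refine h.trans (le_of_eq ?_)
  ring

theorem central_ratio (n : ℕ) :
    ((2 * n + 1).factorial : ℝ) / (2 ^ (2 * n + 1) * (n.factorial : ℝ) ^ 2)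
      ≤ Real.exp 1 / (Real.sqrt 2 * Real.pi) * Real.sqrt ((n : ℝ) + 1) := by
  have hpi := Real.pi_pos
  refine abs_le_of_sq_le_sq' ((central_ratio_sq n).trans ?_) (by positivity) |>.2
  rw [mul_pow, div_pow, mul_pow, Real.sq_sqrt (by positivity), Real.sq_sqrt (by positivity)]
  have he : 2 * Real.pi ≤ Real.exp 1 ^ 2 := by
    have := Real.exp_one_gt_d9
    have := Real.pi_lt_d2
    nlinarith
  rw [div_mul_eq_mul_div, div_le_div_iff₀ (by positivity) (by positivity)]
  have : 0 ≤ ((n : ℝ) + 1) * Real.pi := by positivity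
  nlinarith [mul_le_mul_of_nonneg_left he this]

/-- Stirling-type bound: `(2n+1)!/(2^{2n+1}((n−p)!)²) ≤ (e/(√2 π)) (n+1)^{2p+1/2}`. -/
theorem factorial_ratio_bound (n p : ℕ) (hpn : p ≤ n) :
    ((2 * n + 1).factorial : ℝ) / (2 ^ (2 * n + 1) * ((n - p).factorial : ℝ) ^ 2)
      ≤ Real.exp 1 / (Real.sqrt 2 * Real.pi) *
          ((n : ℝ) + 1) ^ (2 * (p : ℝ) + 1 / 2) := by
  have hn : (0 : ℝ) < (n : ℝ) + 1 := by positivity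
  have hF : (0 : ℝ) < (n.factorial : ℝ) := by exact_mod_cast n.factorial_pos
  have hD : (0 : ℝ) < ((n - p).factorial : ℝ) := by exact_mod_cast (n - p).factorial_pos
  have h1 : (n.factorial : ℝ) ≤ ((n - p).factorial : ℝ) * ((n : ℝ) + 1) ^ p := by
    have h : n.factorial ≤ (n - p).factorial * (n + 1) ^ p := by
      rw [← Nat.factorial_mul_descFactorial hpn]
      exact Nat.mul_le_mul_left _
        ((Nat.descFactorial_le_pow n p).trans (Nat.pow_le_pow_left (Nat.le_succ n) p))
    exact_mod_cast h
  have hx : ((n : ℝ) + 1) ^ (2 * (p : ℝ) + 1 / 2)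
      = Real.sqrt ((n : ℝ) + 1) * (((n : ℝ) + 1) ^ p) ^ 2 := by
    rw [Real.rpow_add hn, ← Real.sqrt_eq_rpow, ← pow_mul, mul_comm, mul_comm p 2]
    congr 1
    exact_mod_cast Real.rpow_natCast ((n : ℝ) + 1) (2 * p)
  rw [hx, ← mul_assoc]
  refine le_trans ?_ (mul_le_mul_of_nonneg_right (central_ratio n) (by positivity))
  rw [div_mul_eq_mul_div, div_le_div_iff₀ (by positivity) (by positivity)]
  have h2 : (n.factorial : ℝ) ^ 2 ≤ (((n - p).factorial : ℝ) * ((n : ℝ) + 1) ^ p) ^ 2 :=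
    pow_le_pow_left₀ hF.le h1 2
  calc _ = (((2 * n + 1).factorial : ℝ) * 2 ^ (2 * n + 1)) * (n.factorial : ℝ) ^ 2 := by ring
    _ ≤ (((2 * n + 1).factorial : ℝ) * 2 ^ (2 * n + 1)) *
        (((n - p).factorial : ℝ) * ((n : ℝ) + 1) ^ p) ^ 2 :=
      mul_le_mul_of_nonneg_left h2 (by positivity)
    _ = _ := by ring
end

section
/- Let T* > 0, let m ≥ 0 be an integer, and let 0 ≤ ξ < T*. Then ∫₀^∞ σ · ℋ_{2m+1}(√(2T*) σ) · e^{−(T*−ξ)σ²} dσ = ((2m+1)!/m!) · √(π T*/2) · (T*−ξ)^{−3/2} · ( (T*+ξ)/(T*−ξ) )^m, where ℋ_k denotes the k-th physicists' Hermite polynomial. -/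
open MeasureTheory Set Filter
open scoped Topology

/-- The `k`-th physicists' Hermite polynomial,
`ℋ_k(x) = k! Σ_{m=0}^{⌊k/2⌋} ((−1)^m/(m!(k−2m)!)) (2x)^{k−2m}`. -/
noncomputable def hermiteP (k : ℕ) (x : ℝ) : ℝ :=
  (k.factorial : ℝ) * ∑ m ∈ Finset.range (k / 2 + 1),
    ((-1) ^ m / ((m.factorial : ℝ) * ((k - 2 * m).factorial : ℝ))) * (2 * x) ^ (k - 2 * m)

lemma aux_Gamma (k : ℕ) : Real.Gamma (k + 3 / 2) =
    ((2 * k + 1).factorial : ℝ) / (k.factorial : ℝ) * Real.sqrt Real.pi / 2 ^ (2 * k + 1) := by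
  induction k with
  | zero =>
    have h : ((0 : ℕ) : ℝ) + 3 / 2 = 1 / 2 + 1 := by norm_num
    rw [h, Real.Gamma_add_one (by norm_num), Real.Gamma_one_half_eq]
    norm_num
    ring
  | succ k ih =>
    have h : ((k + 1 : ℕ) : ℝ) + 3 / 2 = (k + 3 / 2) + 1 := by push_cast; ring
    rw [h, Real.Gamma_add_one (by positivity), ih]
    have h2 : 2 * (k + 1) + 1 = (2 * k + 1) + 1 + 1 := by ring
    have hk : (k.factorial : ℝ) ≠ 0 := by positivity
    rw [h2, Nat.factorial_succ (2 * k + 1 + 1), Nat.factorial_succ (2 * k + 1),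
      Nat.factorial_succ k]
    push_cast
    field_simp
    ring

lemma aux_int_s16 (a : ℝ) (ha : 0 < a) (k : ℕ) :
    IntegrableOn (fun σ : ℝ => σ ^ (2 * k + 2) * Real.exp (-a * σ ^ 2)) (Ioi 0) := by
  have h := integrableOn_rpow_mul_exp_neg_mul_sq ha (s := ((2 * k + 2 : ℕ) : ℝ))
    (lt_of_lt_of_le (by norm_num) (Nat.cast_nonneg _))
  simpa only [Real.rpow_natCast] using h

lemma aux_val (a : ℝ) (ha : 0 < a) (k : ℕ) :
    ∫ σ in Ioi (0:ℝ), σ ^ (2 * k + 2) * Real.exp (-a * σ ^ 2) =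
      ((2 * k + 1).factorial : ℝ) / (k.factorial : ℝ) * Real.sqrt Real.pi / 2 ^ (2 * k + 2)
        * a ^ (-(3:ℝ)/2) / a ^ k := by
  have h := integral_rpow_mul_exp_neg_mul_rpow (p := ((2 : ℕ) : ℝ)) (q := ((2 * k + 2 : ℕ) : ℝ))
    (by norm_num) (lt_of_lt_of_le (by norm_num) (Nat.cast_nonneg _)) ha
  simp only [Real.rpow_natCast] at h
  rw [h]
  have e1 : (((2 * k + 2 : ℕ) : ℝ) + 1) / ((2 : ℕ) : ℝ) = k + 3 / 2 := by push_cast; ring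
  have e2 : -(((2 * k + 2 : ℕ) : ℝ) + 1) / ((2 : ℕ) : ℝ) = -(3:ℝ)/2 - (k : ℝ) := by
    push_cast; ring
  rw [e1, e2, aux_Gamma, Real.rpow_sub ha, Real.rpow_natCast]
  push_cast
  field_simp
  try ring

theorem gaussian_hermite_integral
    (Ts : ℝ) (hTs : 0 < Ts) (m : ℕ) (ξ : ℝ) (hξ0 : 0 ≤ ξ) (hξ : ξ < Ts) :
    ∫ σ in Ioi (0:ℝ),
        σ * hermiteP (2 * m + 1) (Real.sqrt (2 * Ts) * σ) * Real.exp (-(Ts - ξ) * σ ^ 2)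
      = ((2 * m + 1).factorial : ℝ) / (m.factorial : ℝ) * Real.sqrt (Real.pi * Ts / 2) *
          (Ts - ξ) ^ (-(3:ℝ)/2) * ((Ts + ξ) / (Ts - ξ)) ^ m := by
  have ha : 0 < Ts - ξ := by linarith
  have hTa : (Ts + ξ) / (Ts - ξ) = -1 + 2 * Ts / (Ts - ξ) := by field_simp; ring
  have hs2 : Real.sqrt (2 * Ts) ^ 2 = 2 * Ts := Real.sq_sqrt (by positivity)
  have hsq : Real.sqrt (Real.pi * Ts / 2) = Real.sqrt (2 * Ts) * Real.sqrt Real.pi / 2 := by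
    rw [← Real.sqrt_mul (by positivity), Real.sqrt_eq_iff_mul_self_eq (by positivity) (by positivity),
      div_mul_div_comm, Real.mul_self_sqrt (by positivity)]
    ring
  rw [hTa, hsq]
  generalize Ts - ξ = a at *
  generalize Real.sqrt (2 * Ts) = s at *
  have hf : ∀ σ : ℝ, σ * hermiteP (2 * m + 1) (s * σ) * Real.exp (-a * σ ^ 2) =
      ∑ j ∈ Finset.range (m + 1), (((2 * m + 1).factorial : ℝ) *
        ((-1) ^ j / ((j.factorial : ℝ) * ((2 * (m - j) + 1).factorial : ℝ))) *
        (2 * s) ^ (2 * (m - j) + 1)) * (σ ^ (2 * (m - j) + 2) * Real.exp (-a * σ ^ 2)) := by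
    intro σ
    have h0 : (2 * m + 1) / 2 + 1 = m + 1 := by omega
    rw [hermiteP, h0, Finset.mul_sum, Finset.mul_sum, Finset.sum_mul]
    refine Finset.sum_congr rfl fun j hj => ?_
    have h1 : 2 * m + 1 - 2 * j = 2 * (m - j) + 1 := by
      have := Finset.mem_range.1 hj
      omega
    rw [h1]
    ring
  simp_rw [hf]
  rw [integral_finsetSum _ fun j _ => (aux_int_s16 a ha (m - j)).const_mul _]
  simp_rw [integral_const_mul, aux_val a ha]
  rw [add_pow, Finset.mul_sum]
  refine Finset.sum_congr rfl fun j hj => ?_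
  have hjm : j ≤ m := by have := Finset.mem_range.1 hj; omega
  have hc : (m.choose j : ℝ) = m.factorial / (j.factorial * (m - j).factorial) :=
    Nat.cast_choose ℝ hjm
  rw [hc]
  have hp : (2 * s) ^ (2 * (m - j) + 1) = 2 ^ (2 * (m - j) + 1) * (s * (2 * Ts) ^ (m - j)) := by
    rw [mul_pow, pow_succ s, pow_mul s, hs2]; ring
  have hq : (2 : ℝ) ^ (2 * (m - j) + 2) = 2 ^ (2 * (m - j) + 1) * 2 := by ring
  rw [hp, hq, div_pow]
  have f1 : (m.factorial : ℝ) ≠ 0 := by positivity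
  have f2 : (j.factorial : ℝ) ≠ 0 := by positivity
  have f3 : ((m - j).factorial : ℝ) ≠ 0 := by positivity
  have f4 : ((2 * (m - j) + 1).factorial : ℝ) ≠ 0 := by positivity
  have f5 : (2 : ℝ) ^ (2 * (m - j) + 1) ≠ 0 := by positivity
  have f6 : a ^ (m - j) ≠ 0 := by positivity
  generalize (2 : ℝ) ^ (2 * (m - j) + 1) = P at *
  generalize a ^ (-(3:ℝ)/2) = R at *
  generalize a ^ (m - j) = Q at *
  generalize (2 * Ts) ^ (m - j) = U at *
  field_simp
end
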